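/- For every integer N ≥ 2, every global minimizer (f1, g1, l1, m1, c_fl, c_mg, c_ba, t) of the identity-bridge lower-bound problem satisfies (N−1)·g1 − (N−1)·m1 − c_mg − N·c_ba > 0. -/

import Mathlib

/-- The objective `G` of the lower-bound problems:
`G = √((c_fl² + c_mg² + N·c_ba²)/2) + (N−1)·√((f1−m1)² + (g1−l1)² + 4t)`. -/
noncomputable def Gobj (N : ℕ) (f1 g1 l1 m1 cfl cmg cba t : ℝ) : ℝ :=
  Real.sqrt ((cfl ^ 2 + cmg ^ 2 + N * cba ^ 2) / 2) +
    ((N : ℝ) - 1) * Real.sqrt ((f1 - m1) ^ 2 + (g1 - l1) ^ 2 + 4 * t)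

/-- Feasible set of the identity-bridge lower-bound problem. -/
def FeasIdnLB (N : ℕ) (f1 g1 l1 m1 cfl cmg cba t : ℝ) : Prop :=
  1 ≤ f1 ∧ 1 ≤ l1 ∧ 1 ≤ m1 ∧
  ((N : ℝ) - 1) * f1 + cfl + N * cba + N ≤ ((N : ℝ) - 1) * l1 ∧
  ((N : ℝ) - 1) * l1 + N ≤ ((N : ℝ) - 1) * f1 + cfl ∧
  ((N : ℝ) - 1) * g1 + N ≤ ((N : ℝ) - 1) * m1 + cmg ∧
  -g1 + N ≤ ((N : ℝ) - 1) * m1 + cmg ∧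
  f1 * m1 ≤ t ∧
  g1 * l1 ≤ t

/-- Decreasing `c_mg` in absolute value strictly decreases the objective. -/
lemma Gobj_lt_of_cmg_sq_lt {N : ℕ} (f1 g1 l1 m1 cfl cba t : ℝ) {cmg cmg' : ℝ}
    (h : cmg' ^ 2 < cmg ^ 2) :
    Gobj N f1 g1 l1 m1 cfl cmg' cba t < Gobj N f1 g1 l1 m1 cfl cmg cba t :=
  add_lt_add_left (Real.sqrt_lt_sqrt (by positivity) (by linarith)) _

/-- Decreasing the second radicand strictly decreases the objective. -/
lemma Gobj_lt_of_radicand_lt {N : ℕ} (hN : 2 ≤ N) (cfl cmg cba : ℝ)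
    {f1 g1 l1 m1 t f1' g1' l1' m1' t' : ℝ} (ht : 0 ≤ t')
    (h : (f1' - m1') ^ 2 + (g1' - l1') ^ 2 + 4 * t' <
      (f1 - m1) ^ 2 + (g1 - l1) ^ 2 + 4 * t) :
    Gobj N f1' g1' l1' m1' cfl cmg cba t' < Gobj N f1 g1 l1 m1 cfl cmg cba t := by
  have hn : (0 : ℝ) < (N : ℝ) - 1 := by
    have : (2 : ℝ) ≤ N := by exact_mod_cast hN
    linarith
  exact add_lt_add_right
    (mul_lt_mul_of_pos_left (Real.sqrt_lt_sqrt (by positivity) h) hn) _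

/-- Every global minimizer of the identity-bridge
lower-bound problem satisfies `(N−1)·g1 − (N−1)·m1 − c_mg − N·c_ba > 0`. -/
theorem identity_bridge_minimizer_margin_pos (N : ℕ) (hN : 2 ≤ N)
    (f1 g1 l1 m1 cfl cmg cba t : ℝ)
    (hfeas : FeasIdnLB N f1 g1 l1 m1 cfl cmg cba t)
    (hmin : ∀ f1' g1' l1' m1' cfl' cmg' cba' t' : ℝ,
      FeasIdnLB N f1' g1' l1' m1' cfl' cmg' cba' t' →
      Gobj N f1 g1 l1 m1 cfl cmg cba t ≤ Gobj N f1' g1' l1' m1' cfl' cmg' cba' t') :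
    0 < ((N : ℝ) - 1) * g1 - ((N : ℝ) - 1) * m1 - cmg - N * cba := by
  by_contra! hneg
  obtain ⟨hf, hl, hm, hfl, hlf, hgm, hg, hft, hgt⟩ := hfeas
  have hN' : (2 : ℝ) ≤ N := by exact_mod_cast hN
  have hslack : ((N : ℝ) - 1) * g1 + 2 * N ≤ ((N : ℝ) - 1) * m1 + cmg := by linarith
  have ht : 1 ≤ t := by nlinarith
  have hg0 : 0 ≤ g1 := by
    by_contra! hlt
    obtain ⟨g', hg', hg'0, hg'1⟩ : ∃ g', g1 < g' ∧ g' ≤ 0 ∧ g' ≤ g1 + 1 :=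
      ⟨min 0 (g1 + 1), lt_min hlt (by linarith), min_le_left _ _, min_le_right _ _⟩
    refine (hmin f1 g' l1 m1 cfl cmg cba t ⟨hf, hl, hm, hfl, hlf, ?_, by linarith, hft, ?_⟩).not_gt
      (Gobj_lt_of_radicand_lt hN cfl cmg cba (by linarith) (by nlinarith))
    · nlinarith
    · nlinarith
  have hng : 0 ≤ ((N : ℝ) - 1) * g1 := mul_nonneg (by linarith) hg0
  have hc : cmg = 0 := by
    by_contra hne
    obtain ⟨c', hc', hcN⟩ : ∃ c', c' ^ 2 < cmg ^ 2 ∧ cmg - N ≤ c' := by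
      rcases le_total cmg N with h | h
      · exact ⟨0, by rw [zero_pow two_ne_zero]; positivity, by linarith⟩
      · exact ⟨cmg - N, by nlinarith, le_rfl⟩
    exact (hmin f1 g1 l1 m1 cfl c' cba t
      ⟨hf, hl, hm, hfl, hlf, by linarith, by linarith, hft, hgt⟩).not_gt
      (Gobj_lt_of_cmg_sq_lt f1 g1 l1 m1 cfl cba t hc')
  subst hc
  have hm2 : 2 ≤ m1 := by nlinarith
  -- Halving `m1`, `g1` and `t` simultaneously stays feasible and lowers the objective.
  exact (hmin f1 (g1 / 2) l1 (m1 / 2) cfl 0 cba (t / 2)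
    ⟨hf, hl, by linarith, hfl, hlf, by linarith, by linarith, by linarith, by linarith⟩).not_gt
    (Gobj_lt_of_radicand_lt hN cfl 0 cba (by linarith) (by nlinarith))
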